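/- Let G be a finite connected simple chordal graph on n ≥ 2 vertices with exactly p blocks. Then hn_cc(G) = p + 1. -/

import Mathlib

open SimpleGraph

/-- The cycle-convexity interval function: `Icc G S` adds to `S` every vertex `v`
lying on a cycle of the subgraph of `G` induced by `S ∪ {v}`. -/
def Icc {V : Type*} (G : SimpleGraph V) (S : Set V) : Set V :=
  S ∪ {v | ∃ w : (G.induce (insert v S)).Walk ⟨v, Set.mem_insert v S⟩ ⟨v, Set.mem_insert v S⟩,
        w.IsCycle}

/-- A set is convex in the cycle convexity if it is `Icc`-closed. -/
def CcConvex {V : Type*} (G : SimpleGraph V) (S : Set V) : Prop := Icc G S = S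

/-- The convex hull of `S` in the cycle convexity: the smallest convex set containing `S`. -/
def ccHull {V : Type*} (G : SimpleGraph V) (S : Set V) : Set V :=
  ⋂₀ {T : Set V | S ⊆ T ∧ CcConvex G T}

/-- A hull set in the cycle convexity. -/
def IsHullSet {V : Type*} (G : SimpleGraph V) (S : Set V) : Prop := ccHull G S = Set.univ

/-- The hull number in the cycle convexity: minimum cardinality of a hull set. -/
noncomputable def hnCC {V : Type*} (G : SimpleGraph V) : ℕ :=
  sInf {n | ∃ S : Set V, S.ncard = n ∧ IsHullSet G S}


/-- A vertex set `B` induces a connected subgraph of `G` with no cut-vertex of its own: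
removing any vertex of `B` from `G[B]` leaves at most one connected component. -/
def NoCutConn {V : Type*} (G : SimpleGraph V) (B : Set V) : Prop :=
  (G.induce B).Connected ∧
  ∀ v ∈ B, Nat.card ((G.induce (B \ {v})).ConnectedComponent) ≤ 1

/-- A block of `G`: a maximal connected subgraph of `G` having no cut-vertex of its own. -/
def IsBlock {V : Type*} (G : SimpleGraph V) (B : Set V) : Prop :=
  NoCutConn G B ∧ ∀ B' : Set V, B ⊆ B' → NoCutConn G B' → B' = B

/-- A graph is chordal if it has no induced cycle of length greater than 3;
equivalently, every cycle of length at least 4 has a chord. -/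
def Chordal {V : Type*} (G : SimpleGraph V) : Prop :=
  ∀ ⦃v : V⦄ (w : G.Walk v v), w.IsCycle → 4 ≤ w.length →
    ∃ x y, x ∈ w.support ∧ y ∈ w.support ∧ G.Adj x y ∧ ¬ w.toSubgraph.Adj x y

lemma mem_of_mem_support_map_induce {V : Type*} {G : SimpleGraph V} {A : Set V} {x y : A}
    (p : (G.induce A).Walk x y) {z : V}
    (hz : z ∈ (p.map (SimpleGraph.Embedding.induce A).toHom).support) : z ∈ A := by
  rw [SimpleGraph.Walk.support_map, List.mem_map] at hz
  obtain ⟨u, -, rfl⟩ := hz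
  exact u.2

lemma ccConvex_iff {V : Type*} {G : SimpleGraph V} {T : Set V} :
    CcConvex G T ↔ ∀ v, ∀ w : G.Walk v v, w.IsCycle → (∀ z ∈ w.support, z ∈ insert v T) →
      v ∈ T := by
  unfold CcConvex Icc
  rw [Set.union_eq_left]
  constructor
  · intro h v w hw hs
    refine h ⟨w.induce (insert v T) hs, ?_⟩
    apply SimpleGraph.Walk.IsCycle.of_map (f := (SimpleGraph.Embedding.induce (insert v T)).toHom)
    rw [SimpleGraph.Walk.map_induce]
    exact hw
  · rintro h v ⟨w, hw⟩
    refine h v (w.map (SimpleGraph.Embedding.induce (insert v T)).toHom)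
      (hw.map (SimpleGraph.Embedding.induce (G := G) (insert v T)).injective)
      fun z hz => mem_of_mem_support_map_induce w hz

lemma subset_ccHull {V : Type*} (G : SimpleGraph V) (S : Set V) : S ⊆ ccHull G S :=
  Set.subset_sInter fun _ hT => hT.1

lemma ccHull_subset {V : Type*} {G : SimpleGraph V} {S T : Set V} (hST : S ⊆ T)
    (hT : CcConvex G T) : ccHull G S ⊆ T :=
  Set.sInter_subset_of_mem ⟨hST, hT⟩

lemma ccConvex_ccHull {V : Type*} (G : SimpleGraph V) (S : Set V) : CcConvex G (ccHull G S) := by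
  rw [ccConvex_iff]
  intro v w hw hs T hT
  refine ccConvex_iff.1 hT.2 v w hw fun z hz => ?_
  exact Set.insert_subset_insert (Set.sInter_subset_of_mem hT) (hs z hz)

lemma CcConvex.mem_of_triangle {V : Type*} {G : SimpleGraph V} {T : Set V} (hT : CcConvex G T)
    {a b c : V} (hab : G.Adj a b) (hbc : G.Adj b c) (hca : G.Adj c a) (ha : a ∈ T) (hb : b ∈ T) :
    c ∈ T := by
  refine ccConvex_iff.1 hT c (.cons hca (.cons hab (.cons hbc .nil))) ?_ ?_
  · rw [SimpleGraph.Walk.cons_isCycle_iff]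
    have := hab.ne
    have := hbc.ne
    have := hca.ne
    constructor
    · simp [*, this.symm]
    · simp [*]
      grind
  · simp [ha, hb]

/-- In a chordal graph, a convex set containing an edge of a cycle contains the whole cycle. -/
lemma Chordal.support_subset_of_ccConvex {V : Type*} {G : SimpleGraph V} (hG : Chordal G)
    {T : Set V} (hT : CcConvex G T) (n : ℕ) : ∀ {a b : V} (p : G.Walk a b), p.IsPath →
      p.length ≤ n → 2 ≤ p.length → G.Adj b a → a ∈ T → b ∈ T → ∀ z ∈ p.support, z ∈ T := by
  classical
  induction n with
  | zero => intro a b p _ h h'; omega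
  | succ n ih =>
    intro a b p hp hn h2 hba ha hb
    have split : ∀ (x y : V) (p₁ : G.Walk a x) (p₂ : G.Walk x y) (p₃ : G.Walk y b),
        p = p₁.append (p₂.append p₃) → G.Adj x y → s(x, y) ∉ p.edges → s(x, y) ≠ s(a, b) →
        ∀ z ∈ p.support, z ∈ T := by
      intro x y p₁ p₂ p₃ hpe hxy hne hnab
      have hlen : p.length = p₁.length + (p₂.length + p₃.length) := by simp [hpe]
      have hp₂ : 2 ≤ p₂.length := by
        match p₂, hpe with
        | .nil, _ => exact absurd rfl hxy.ne
        | .cons h .nil, hpe => simp [hpe] at hne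
        | .cons h (.cons h' q), _ => simp
      have h13 : 1 ≤ p₁.length + p₃.length := by
        by_contra hlt
        have h1 := SimpleGraph.Walk.eq_of_length_eq_zero (p := p₁) (by omega)
        have h3 := SimpleGraph.Walk.eq_of_length_eq_zero (p := p₃) (by omega)
        exact hnab (by rw [h1, h3])
      have hyt : y ∈ p₂.support.tail := SimpleGraph.Walk.end_mem_tail_support (by
        rw [← SimpleGraph.Walk.length_eq_zero_iff]; omega)
      have hq : (p₁.append (.cons hxy p₃)).IsPath := by
        rw [SimpleGraph.Walk.isPath_def] at hp ⊢
        refine hp.sublist ?_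
        rw [hpe, SimpleGraph.Walk.support_append, SimpleGraph.Walk.support_append,
          SimpleGraph.Walk.support_append, SimpleGraph.Walk.support_cons, List.tail_cons,
          List.tail_append_of_ne_nil (by simp), ← p₃.cons_tail_support]
        exact (List.Sublist.refl _).append
          ((List.singleton_sublist.2 hyt).append (List.Sublist.refl _))
      have hqT := ih (p₁.append (.cons hxy p₃)) hq (by simp; omega) (by simp; omega) hba ha hb
      have hxT : x ∈ T := hqT x (by simp)
      have hyT : y ∈ T := hqT y (by simp)
      have hp₂T := ih p₂ (hpe ▸ hp).of_append_right.of_append_left (by omega) hp₂ hxy.symm hxT hyT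
      intro z hz
      rw [hpe, SimpleGraph.Walk.mem_support_append_iff,
        SimpleGraph.Walk.mem_support_append_iff] at hz
      rcases hz with hz | hz | hz
      · exact hqT z (by simp [hz])
      · exact hp₂T z hz
      · exact hqT z (by simp [hz])
    rcases h2.eq_or_lt with h2 | h3
    · match p, h2 with
      | .cons h (.cons h' .nil), _ =>
        have := hT.mem_of_triangle hba h h' hb ha
        simp [ha, hb, this]
    · have hcyc : (SimpleGraph.Walk.cons hba p).IsCycle := by
        rw [SimpleGraph.Walk.cons_isCycle_iff]
        refine ⟨hp, fun hmem => ?_⟩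
        have := hp.length_eq_one_of_mem_edges (by rwa [Sym2.eq_swap])
        omega
      obtain ⟨x, y, hx, hy, hxy, hne⟩ := hG _ hcyc (by simp; omega)
      rw [SimpleGraph.Walk.adj_toSubgraph_iff_mem_edges] at hne
      simp only [SimpleGraph.Walk.edges_cons, List.mem_cons, not_or] at hne
      have mem_of : ∀ u, u ∈ (SimpleGraph.Walk.cons hba p).support → u ∈ p.support := by
        intro u hu
        rw [SimpleGraph.Walk.support_cons, List.mem_cons] at hu
        rcases hu with rfl | hu
        · simp
        · exact hu
      replace hx := mem_of x hx
      replace hy := mem_of y hy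
      have hy' := hy
      rw [← p.take_spec hx, SimpleGraph.Walk.mem_support_append_iff] at hy'
      rcases hy' with hy' | hy'
      · refine split y x ((p.takeUntil x hx).takeUntil y hy') ((p.takeUntil x hx).dropUntil y hy')
          (p.dropUntil x hx) ?_ hxy.symm ?_ ?_
        · rw [SimpleGraph.Walk.append_assoc, SimpleGraph.Walk.take_spec,
            SimpleGraph.Walk.take_spec]
        · rw [Sym2.eq_swap]; exact hne.2
        · rw [Sym2.eq_swap, Sym2.eq_swap (a := a)]; exact hne.1
      · refine split x y (p.takeUntil x hx) ((p.dropUntil x hx).takeUntil y hy')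
          ((p.dropUntil x hx).dropUntil y hy') ?_ hxy hne.2 ?_
        · rw [SimpleGraph.Walk.take_spec, SimpleGraph.Walk.take_spec]
        · rw [Sym2.eq_swap (a := a)]; exact hne.1

/-- `x` and `y` are joined by a walk of `G` staying inside `A`. -/
def WalkJoined {V : Type*} (G : SimpleGraph V) (A : Set V) (x y : V) : Prop :=
  ∃ p : G.Walk x y, ∀ z ∈ p.support, z ∈ A

namespace WalkJoined

variable {V : Type*} {G : SimpleGraph V} {A A' : Set V} {x y z : V}

lemma refl (h : x ∈ A) : WalkJoined G A x x := ⟨.nil, by simpa using h⟩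

lemma symm (h : WalkJoined G A x y) : WalkJoined G A y x := by
  obtain ⟨p, hp⟩ := h
  exact ⟨p.reverse, by simpa using hp⟩

lemma trans (h : WalkJoined G A x y) (h' : WalkJoined G A y z) : WalkJoined G A x z := by
  obtain ⟨p, hp⟩ := h
  obtain ⟨q, hq⟩ := h'
  refine ⟨p.append q, fun u hu => ?_⟩
  rcases (SimpleGraph.Walk.mem_support_append_iff _ _).1 hu with hu | hu
  exacts [hp u hu, hq u hu]

lemma mono (h : WalkJoined G A x y) (hA : A ⊆ A') : WalkJoined G A' x y := by
  obtain ⟨p, hp⟩ := h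
  exact ⟨p, fun u hu => hA (hp u hu)⟩

end WalkJoined

lemma induce_preconnected_iff {V : Type*} {G : SimpleGraph V} {A : Set V} :
    (G.induce A).Preconnected ↔ ∀ x ∈ A, ∀ y ∈ A, WalkJoined G A x y := by
  constructor
  · intro h x hx y hy
    obtain ⟨p⟩ := h ⟨x, hx⟩ ⟨y, hy⟩
    refine ⟨p.map (SimpleGraph.Embedding.induce A).toHom,
      fun z hz => mem_of_mem_support_map_induce p hz⟩
  · rintro h ⟨x, hx⟩ ⟨y, hy⟩
    obtain ⟨p, hp⟩ := h x hx y hy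
    exact ⟨p.induce A hp⟩

lemma noCutConn_iff {V : Type*} [Finite V] {G : SimpleGraph V} {B : Set V} :
    NoCutConn G B ↔ B.Nonempty ∧ (∀ x ∈ B, ∀ y ∈ B, WalkJoined G B x y) ∧
      ∀ v, ∀ x ∈ B \ {v}, ∀ y ∈ B \ {v}, WalkJoined G (B \ {v}) x y := by
  have key : ∀ v, Nat.card (G.induce (B \ {v})).ConnectedComponent ≤ 1 ↔
      ∀ x ∈ B \ {v}, ∀ y ∈ B \ {v}, WalkJoined G (B \ {v}) x y := by
    intro v
    rw [Finite.card_le_one_iff_subsingleton, ← induce_preconnected_iff]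
    constructor
    · intro h x y
      exact SimpleGraph.ConnectedComponent.exact (Subsingleton.elim _ _)
    · exact fun h => h.subsingleton_connectedComponent
  unfold NoCutConn
  rw [SimpleGraph.connected_iff, induce_preconnected_iff, Set.nonempty_coe_sort]
  constructor
  · rintro ⟨⟨h1, h2⟩, h3⟩
    refine ⟨h2, h1, fun v => ?_⟩
    by_cases hv : v ∈ B
    · exact (key v).1 (h3 v hv)
    · rw [Set.sdiff_singleton_eq_self hv]
      exact h1
  · rintro ⟨h2, h1, h3⟩
    exact ⟨⟨h1, h2⟩, fun v _ => (key v).2 (h3 v)⟩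

/-- If every vertex of `C` is joined inside `C` to some vertex of `A`, and `A` is connected, then
`C` is connected. -/
lemma walkJoined_of_forall_exists {V : Type*} {G : SimpleGraph V} {A C : Set V} (hAC : A ⊆ C)
    (hA : ∀ x ∈ A, ∀ y ∈ A, WalkJoined G A x y) (h : ∀ x ∈ C, ∃ a ∈ A, WalkJoined G C x a) :
    ∀ x ∈ C, ∀ y ∈ C, WalkJoined G C x y := by
  intro x hx y hy
  obtain ⟨a, ha, hxa⟩ := h x hx
  obtain ⟨b, hb, hyb⟩ := h y hy
  exact hxa.trans (((hA a ha b hb).mono hAC).trans hyb.symm)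

lemma NoCutConn.union {V : Type*} [Finite V] {G : SimpleGraph V} {B C : Set V}
    (hB : NoCutConn G B) (hC : NoCutConn G C) {x y : V} (hxy : x ≠ y) (hx : x ∈ B ∩ C)
    (hy : y ∈ B ∩ C) : NoCutConn G (B ∪ C) := by
  rw [noCutConn_iff] at *
  refine ⟨hB.1.inl, ?_, fun v => ?_⟩
  · refine walkJoined_of_forall_exists Set.subset_union_left hB.2.1 ?_
    rintro z (hz | hz)
    · exact ⟨z, hz, .refl (.inl hz)⟩
    · exact ⟨x, hx.1, (hC.2.1 z hz x hx.2).mono Set.subset_union_right⟩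
  · obtain ⟨u, huv, hu⟩ : ∃ u, u ≠ v ∧ u ∈ B ∩ C := by
      by_cases h : x = v
      · exact ⟨y, fun h' => hxy (h.trans h'.symm), hy⟩
      · exact ⟨x, h, hx⟩
    refine walkJoined_of_forall_exists (Set.sdiff_subset_sdiff_left Set.subset_union_left)
      (hB.2.2 v) ?_
    rintro z ⟨hz | hz, hzv⟩
    · exact ⟨z, ⟨hz, hzv⟩, .refl ⟨.inl hz, hzv⟩⟩
    · exact ⟨u, ⟨hu.1, huv⟩, (hC.2.2 v z ⟨hz, hzv⟩ u ⟨hu.2, huv⟩).mono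
        (Set.sdiff_subset_sdiff_left Set.subset_union_right)⟩

/-- Adding to a vertex set without cut-vertex a path with both ends in the set gives a vertex
set without cut-vertex. -/
lemma NoCutConn.union_support {V : Type*} [Finite V] {G : SimpleGraph V} {B : Set V}
    (hB : NoCutConn G B) {x y : V} (hx : x ∈ B) (hy : y ∈ B) (p : G.Walk x y)
    (hp : p.IsPath) : NoCutConn G (B ∪ {z | z ∈ p.support}) := by
  classical
  rw [noCutConn_iff] at *
  refine ⟨hB.1.inl, ?_, fun v => ?_⟩
  · refine walkJoined_of_forall_exists Set.subset_union_left hB.2.1 ?_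
    rintro z (hz | hz)
    · exact ⟨z, hz, .refl (.inl hz)⟩
    · exact ⟨y, hy, p.dropUntil z hz,
        fun u hu => .inr (p.support_dropUntil_subset_support hz hu)⟩
  · refine walkJoined_of_forall_exists (Set.sdiff_subset_sdiff_left Set.subset_union_left)
      (hB.2.2 v) ?_
    rintro z ⟨hz | hz, hzv⟩
    · exact ⟨z, ⟨hz, hzv⟩, .refl ⟨.inl hz, hzv⟩⟩
    · by_cases hv : v ∈ (p.dropUntil z hz).support
      · have hv' : v ∉ (p.takeUntil z hz).support := by
          intro hv'
          rw [← p.take_spec hz, SimpleGraph.Walk.isPath_def, SimpleGraph.Walk.support_append,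
            List.nodup_append] at hp
          rw [← SimpleGraph.Walk.cons_tail_support, List.mem_cons] at hv
          rcases hv with hv | hv
          · exact hzv hv.symm
          · exact hp.2.2 v hv' v hv rfl
        refine ⟨x, ⟨hx, fun h => hv' ?_⟩, (p.takeUntil z hz).reverse, fun u hu => ?_⟩
        · rw [← Set.mem_singleton_iff.1 h]
          simp
        · rw [SimpleGraph.Walk.support_reverse, List.mem_reverse] at hu
          exact ⟨.inr (p.support_takeUntil_subset_support hz hu), fun h => hv' (h ▸ hu)⟩
      · refine ⟨y, ⟨hy, fun h => hv ?_⟩, p.dropUntil z hz, fun u hu => ?_⟩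
        · rw [← Set.mem_singleton_iff.1 h]
          simp
        · exact ⟨.inr (p.support_dropUntil_subset_support hz hu), fun h => hv (h ▸ hu)⟩

lemma noCutConn_pair {V : Type*} [Finite V] {G : SimpleGraph V} {x y : V} (h : G.Adj x y) :
    NoCutConn G {x, y} := by
  rw [noCutConn_iff]
  have hxy : WalkJoined G {x, y} x y := ⟨.cons h .nil, by simp⟩
  refine ⟨⟨x, by simp⟩, ?_, fun v a ha b hb => ?_⟩
  · rintro a (rfl | rfl) b (rfl | rfl)
    exacts [.refl (by simp), hxy, hxy.symm, .refl (by simp)]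
  · obtain rfl | hab := eq_or_ne a b
    · exact .refl ha
    · have hv : v ∉ ({x, y} : Set V) := by
        have := ha.1; have := ha.2; have := hb.1; have := hb.2
        simp at *
        grind
      rw [Set.sdiff_singleton_eq_self hv] at *
      rcases ha with rfl | rfl <;> rcases hb with rfl | rfl
      exacts [absurd rfl hab, hxy, hxy.symm, absurd rfl hab]

lemma NoCutConn.exists_isBlock {V : Type*} [Finite V] {G : SimpleGraph V} {A : Set V}
    (hA : NoCutConn G A) : ∃ B, IsBlock G B ∧ A ⊆ B := by
  obtain ⟨B, hAB, hB⟩ := (Set.toFinite {B : Set V | NoCutConn G B}).exists_le_maximal hA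
  exact ⟨B, ⟨hB.1, fun B' h h' => (hB.2 h' h).antisymm h⟩, hAB⟩

lemma IsBlock.eq_of_two_common {V : Type*} [Finite V] {G : SimpleGraph V} {B C : Set V}
    (hB : IsBlock G B) (hC : IsBlock G C) {x y : V} (hxy : x ≠ y) (hx : x ∈ B ∩ C)
    (hy : y ∈ B ∩ C) : B = C := by
  have h := hB.1.union hC.1 hxy hx hy
  rw [← hB.2 _ Set.subset_union_left h]
  exact hC.2 _ Set.subset_union_right h

lemma IsBlock.exists_ne {V : Type*} [Finite V] [Nontrivial V] {G : SimpleGraph V}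
    (hG : G.Connected) {B : Set V} (hB : IsBlock G B) : ∃ x ∈ B, ∃ y ∈ B, x ≠ y := by
  by_contra! h
  obtain ⟨x, hx⟩ := (noCutConn_iff.1 hB.1).1
  obtain ⟨y, hxy⟩ := hG.preconnected.exists_adj_of_nontrivial x
  have hBx : B ⊆ {x, y} := fun z hz => .inl (h z hz x hx)
  have hy : y ∈ B := hB.2 _ hBx (noCutConn_pair hxy) ▸ (by simp : y ∈ ({x, y} : Set V))
  exact hxy.ne (h x hx y hy)

/-- In a chordal graph, a convex set containing an edge of a set without cut-vertex contains the
whole set. -/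
lemma Chordal.subset_of_ccConvex {V : Type*} [Finite V] {G : SimpleGraph V} (hG : Chordal G)
    {T B : Set V} (hT : CcConvex G T) (hB : NoCutConn G B) {x y : V} (hxy : G.Adj x y)
    (hx : x ∈ B ∩ T) (hy : y ∈ B ∩ T) : B ⊆ T := by
  classical
  rw [noCutConn_iff] at hB
  let K : Set V := {u | u ∈ B ∩ T ∧ ∃ u' ∈ B ∩ T, G.Adj u u'}
  suffices B ⊆ K from fun z hz => (this hz).1.2
  intro z hz
  by_contra hzK
  obtain ⟨p, hp⟩ := hB.2.1 x hx.1 z hz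
  obtain ⟨d, hd, hdK, hdK'⟩ := p.exists_boundary_dart K ⟨hx, y, hy, hxy⟩ hzK
  have hdB := hp _ (p.dart_snd_mem_support_of_mem_darts hd)
  obtain ⟨hu, u', hu', huu'⟩ := hdK
  have hdT : d.snd ∉ T := fun h => hdK' ⟨⟨hdB, h⟩, d.fst, hu, d.adj.symm⟩
  have hne : d.snd ≠ u' := fun h => hdT (h ▸ hu'.2)
  obtain ⟨q, hq⟩ := hB.2.2 d.fst u' ⟨hu'.1, huu'.ne'⟩ d.snd ⟨hdB, d.adj.ne'⟩
  have hq' : ∀ w ∈ q.bypass.support, w ≠ d.fst := fun w hw =>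
    (hq w (q.support_bypass_subset_support hw)).2
  refine hdT (hG.support_subset_of_ccConvex hT _ (.cons d.adj q.bypass.reverse) ?_ le_rfl ?_
    huu'.symm hu.2 hu'.2 d.snd (by simp))
  · rw [SimpleGraph.Walk.cons_isPath_iff]
    refine ⟨q.bypass_isPath.reverse, fun h => hq' d.fst (by simpa using h) rfl⟩
  · have : q.bypass.length ≠ 0 := fun h => hne (SimpleGraph.Walk.eq_of_length_eq_zero h).symm
    simp only [SimpleGraph.Walk.length_cons, SimpleGraph.Walk.length_reverse]
    omega

/-- A function separating the vertices of the block `B` and constant along all other edges. -/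
lemma IsBlock.exists_coordinate {V : Type*} [Finite V] {G : SimpleGraph V} {B : Set V}
    (hB : IsBlock G B) : ∃ f : V → ℚ, Set.InjOn f B ∧
      ∀ x y, G.Adj x y → ¬ (x ∈ B ∧ y ∈ B) → f x = f y := by
  classical
  let H : SimpleGraph V := G.deleteEdges {e | ∀ z ∈ e, z ∈ B}
  obtain ⟨n, ⟨e⟩⟩ := Finite.exists_equiv_fin H.ConnectedComponent
  refine ⟨fun v => ((e (H.connectedComponentMk v) : ℕ) : ℚ), ?_, ?_⟩
  · intro x hx y hy hxy
    have hxy : H.Reachable x y := by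
      rw [Nat.cast_inj, Fin.val_inj, e.apply_eq_iff_eq] at hxy
      exact SimpleGraph.ConnectedComponent.exact hxy
    by_contra hne
    obtain ⟨p, hp⟩ := hxy.exists_isPath
    have hle : H ≤ G := SimpleGraph.deleteEdges_le _
    have hU := hB.1.union_support hx hy (p.mapLe hle) (hp.mapLe hle)
    have hpB : ∀ z ∈ p.support, z ∈ B := fun z hz => by
      rw [← hB.2 _ Set.subset_union_left hU]
      exact .inr (by simpa using hz)
    cases p with
    | nil => exact hne rfl
    | cons h q =>
      rw [SimpleGraph.deleteEdges_adj] at h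
      refine h.2 fun z hz => ?_
      rcases Sym2.mem_iff.1 hz with rfl | rfl
      · exact hx
      · exact hpB _ (by simp)
  · intro x y hxy hn
    have : H.Adj x y := by
      rw [SimpleGraph.deleteEdges_adj]
      exact ⟨hxy, fun h => hn ⟨h x (by simp), h y (by simp)⟩⟩
    simp only [SimpleGraph.ConnectedComponent.sound this.reachable]

lemma WalkJoined.eq_of_forall_adj {V : Type*} {G : SimpleGraph V} {A : Set V} {x y : V}
    (h : WalkJoined G A x y) {f : V → ℚ}
    (hf : ∀ u ∈ A, ∀ v ∈ A, G.Adj u v → f u = f v) : f x = f y := by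
  obtain ⟨p, hp⟩ := h
  induction p with
  | nil => rfl
  | cons h q ih =>
    exact (hf _ (hp _ (by simp)) _ (hp _ (by simp)) h).trans
      (ih fun z hz => hp z (by simp [hz]))

/-- Every cycle lies in a block. -/
lemma exists_isBlock_of_isCycle {V : Type*} [Finite V] {G : SimpleGraph V} {v : V}
    {w : G.Walk v v} (hw : w.IsCycle) : ∃ B, IsBlock G B ∧ ∀ z ∈ w.support, z ∈ B := by
  cases w with
  | nil => simp at hw
  | cons h p =>
    rw [SimpleGraph.Walk.cons_isCycle_iff] at hw
    obtain ⟨B, hB, hsub⟩ :=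
      ((noCutConn_pair h).union_support (by simp) (by simp) p hw.1).exists_isBlock
    refine ⟨B, hB, fun z hz => hsub ?_⟩
    rw [SimpleGraph.Walk.support_cons, List.mem_cons] at hz
    rcases hz with rfl | hz
    · exact .inl (by simp)
    · exact .inr hz

/-- A hull set has more vertices than there are blocks. -/
lemma IsHullSet.ncard_blocks_lt {V : Type*} [Finite V] [Nontrivial V] {G : SimpleGraph V}
    (hG : G.Connected) {S : Set V} (hS : IsHullSet G S) :
    {B : Set V | IsBlock G B}.ncard < S.ncard := by
  classical
  have := Fintype.ofFinite V
  by_contra! hlt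
  choose f hinj hconst using fun B : {B : Set V // IsBlock G B} => B.2.exists_coordinate
  have hconst' : ∀ B C : {B : Set V // IsBlock G B}, B ≠ C → ∀ x ∈ C.1, ∀ y ∈ C.1,
      f B x = f B y := by
    intro B C hBC x hx y hy
    refine ((noCutConn_iff.1 C.2.1).2.1 x hx y hy).eq_of_forall_adj fun u hu v hv huv => ?_
    refine hconst B u v huv fun h => hBC (Subtype.ext ?_)
    exact B.2.eq_of_two_common C.2 huv.ne ⟨h.1, hu⟩ ⟨h.2, hv⟩
  let ev : (Option {B : Set V // IsBlock G B} → ℚ) →ₗ[ℚ] (V → ℚ) :=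
    { toFun := fun c v => c none + ∑ B, c (some B) * f B v
      map_add' := fun c d => by
        ext v
        simp only [Pi.add_apply, add_mul, Finset.sum_add_distrib]
        ring
      map_smul' := fun r c => by
        ext v
        simp only [Pi.smul_apply, smul_eq_mul, RingHom.id_apply, mul_add, Finset.mul_sum,
          mul_assoc] }
  have hev : ∀ c (C : {B : Set V // IsBlock G B}), ∀ x ∈ C.1, ∀ y ∈ C.1,
      ev c x - ev c y = c (some C) * (f C x - f C y) := by
    intro c C x hx y hy
    change (c none + ∑ B, c (some B) * f B x) - (c none + ∑ B, c (some B) * f B y) = _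
    rw [add_sub_add_left_eq_sub, ← Finset.sum_sub_distrib, Finset.sum_eq_single C]
    · ring
    · intro B _ hBC
      rw [hconst' B C hBC x hx y hy, sub_self]
    · simp
  obtain ⟨c, hcS, hc⟩ : ∃ c, (∀ v ∈ S, ev c v = 0) ∧ c ≠ 0 := by
    have hker := LinearMap.ker_ne_bot_of_finrank_lt
      (f := (LinearMap.funLeft ℚ ℚ (Subtype.val : S → V)).comp ev) (by
        rw [Module.finrank_pi, Module.finrank_pi, Fintype.card_option, ← Nat.card_eq_fintype_card,
          ← Nat.card_eq_fintype_card, Nat.card_coe_set_eq]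
        exact Nat.lt_succ_of_le hlt)
    obtain ⟨c, hc, hc0⟩ := Submodule.exists_mem_ne_zero_of_ne_bot hker
    exact ⟨c, fun v hv => congrFun (LinearMap.mem_ker.1 hc) ⟨v, hv⟩, hc0⟩
  have hconv : CcConvex G {v | ev c v = 0} := by
    rw [ccConvex_iff]
    intro v w hw hs
    obtain ⟨B, hB, hwB⟩ := exists_isBlock_of_isCycle hw
    have hmem : ∀ z ∈ w.support, z ≠ v → ev c z = 0 := fun z hz hzv =>
      (hs z hz).resolve_left hzv
    have hsv : w.snd ≠ v := (w.adj_snd hw.not_nil).ne'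
    have hpv : w.penultimate ≠ v := (w.adj_penultimate hw.not_nil).ne
    have hs0 := hmem w.snd (w.getVert_mem_support _) hsv
    have hp0 := hmem w.penultimate (w.getVert_mem_support _) hpv
    have h1 := hev c ⟨B, hB⟩ w.snd (hwB _ (w.getVert_mem_support _)) w.penultimate
      (hwB _ (w.getVert_mem_support _))
    have h2 := hev c ⟨B, hB⟩ v (hwB _ w.start_mem_support) w.penultimate
      (hwB _ (w.getVert_mem_support _))
    rw [hs0, hp0, sub_self, zero_eq_mul, sub_eq_zero] at h1
    rcases h1 with h1 | h1
    · rw [h1, hp0, zero_mul, sub_zero] at h2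
      exact h2
    · exact absurd (hinj ⟨B, hB⟩ (hwB _ (w.getVert_mem_support _))
        (hwB _ (w.getVert_mem_support _)) h1) hw.snd_ne_penultimate
  have hzero : ∀ v, ev c v = 0 := by
    intro v
    have hv : v ∈ ccHull G S := by rw [show ccHull G S = Set.univ from hS]; trivial
    exact ccHull_subset hcS hconv hv
  have hsome : ∀ B, c (some B) = 0 := by
    intro B
    obtain ⟨x, hx, y, hy, hxy⟩ := B.2.exists_ne hG
    have h := hev c B x hx y hy
    rw [hzero, hzero, sub_self, zero_eq_mul, sub_eq_zero] at h
    exact h.resolve_right fun h => hxy (hinj B hx hy h)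
  refine hc (funext fun o => ?_)
  cases o with
  | some B => exact hsome B
  | none =>
    have h : c none + ∑ B, c (some B) * f B (Classical.arbitrary V) = 0 := hzero _
    simpa [hsome] using h

/-- In a connected chordal graph, some hull set has at most one vertex more than there are
blocks. -/
lemma Chordal.exists_isHullSet {V : Type*} [Finite V] {G : SimpleGraph V} (hG : Chordal G)
    (hconn : G.Connected) :
    ∃ S, IsHullSet G S ∧ S.ncard ≤ {B : Set V | IsBlock G B}.ncard + 1 := by
  suffices ∀ (n : ℕ) (S : Set V), (ccHull G S)ᶜ.ncard ≤ n → S.Nonempty →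
      S.ncard ≤ {B | IsBlock G B ∧ B ⊆ ccHull G S}.ncard + 1 →
      ∃ S, IsHullSet G S ∧ S.ncard ≤ {B : Set V | IsBlock G B}.ncard + 1 by
    obtain ⟨v⟩ := hconn.nonempty
    exact this _ {v} le_rfl (Set.singleton_nonempty v) (by simp)
  intro n
  induction n with
  | zero =>
    intro S hn _ hS
    rw [Nat.le_zero, Set.ncard_eq_zero, Set.compl_empty_iff] at hn
    refine ⟨S, hn, hS.trans (Nat.succ_le_succ (Set.ncard_le_ncard fun B hB => hB.1))⟩
  | succ n ih =>
    intro S hn hne hS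
    obtain ⟨u, hu⟩ := hne.mono (subset_ccHull G S)
    by_cases h : ∃ v, v ∉ ccHull G S
    · obtain ⟨v, hv⟩ := h
      obtain ⟨p⟩ := hconn.preconnected u v
      obtain ⟨d, -, hx, hy⟩ := p.exists_boundary_dart _ hu hv
      obtain ⟨B, hB, hxyB⟩ := (noCutConn_pair d.adj).exists_isBlock
      have hsub : ccHull G S ⊆ ccHull G (insert d.snd S) :=
        ccHull_subset ((Set.subset_insert _ _).trans (subset_ccHull G _)) (ccConvex_ccHull G _)
      have hy' : d.snd ∈ ccHull G (insert d.snd S) := subset_ccHull G _ (Set.mem_insert _ _)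
      have hBsub : B ⊆ ccHull G (insert d.snd S) :=
        hG.subset_of_ccConvex (ccConvex_ccHull G _) hB.1 d.adj ⟨hxyB (by simp), hsub hx⟩
          ⟨hxyB (by simp), hy'⟩
      refine ih (insert d.snd S) ?_ (Set.insert_nonempty _ _) ?_
      · have : (ccHull G (insert d.snd S))ᶜ.ncard < (ccHull G S)ᶜ.ncard :=
          Set.ncard_lt_ncard ⟨Set.compl_subset_compl.2 hsub, fun h => h hy hy'⟩
        omega
      · have hlt : {B | IsBlock G B ∧ B ⊆ ccHull G S}.ncard <
            {B | IsBlock G B ∧ B ⊆ ccHull G (insert d.snd S)}.ncard :=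
          Set.ncard_lt_ncard ⟨fun C hC => ⟨hC.1, hC.2.trans hsub⟩,
            fun h => hy ((h ⟨hB, hBsub⟩).2 (hxyB (by simp)))⟩
        have := Set.ncard_insert_le d.snd S
        omega
    · push Not at h
      refine ⟨S, Set.eq_univ_of_forall h,
        hS.trans (Nat.succ_le_succ (Set.ncard_le_ncard fun B hB => hB.1))⟩

/-- A connected simple chordal graph on at least 2 vertices with exactly `p` blocks satisfies
`hn_cc(G) = p + 1`. -/
theorem hnCC_chordal_eq_blocks_add_one {V : Type*} [Fintype V] (G : SimpleGraph V)
    (hchordal : Chordal G) (hconn : G.Connected) (hn : 2 ≤ Fintype.card V) (p : ℕ)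
    (hp : {B : Set V | IsBlock G B}.ncard = p) :
    hnCC G = p + 1 := by
  have : Nontrivial V := Fintype.one_lt_card_iff_nontrivial.1 hn
  obtain ⟨S, hS, hcard⟩ := hchordal.exists_isHullSet hconn
  rw [hp] at hcard
  refine le_antisymm (le_trans (Nat.sInf_le ⟨S, rfl, hS⟩) hcard) (le_csInf ⟨_, S, rfl, hS⟩ ?_)
  rintro _ ⟨T, rfl, hT⟩
  have := hT.ncard_blocks_lt hconn
  omega
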